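/- arXiv:2604.26391 — 2 statements merged into one kernel-verified Lean document; each statement's English description precedes it below -/
import Mathlib

section
/- In the multi-server secure aggregation model with heterogeneous security constraints, suppose e* ≤ K−1, a* = |𝒮̄|, and |𝒬| = K. Then every rate tuple (R_X, R_Y, R_{Z_Σ}) with R_X ≥ 1, R_Y ≥ 1 and R_{Z_Σ} ≥ e* + b* is achievable, where b* is the optimal value of the stated linear program. -/
open Finset

open scoped Classical

noncomputable section

/-- Probability that the random variable `X` takes the value `s`, under the weights `μ`. -/
def prb {Ω : Type} [Fintype Ω] (μ : Ω → ℝ) {α : Type} (X : Ω → α) (s : α) : ℝ :=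
  ∑ ω ∈ Finset.univ.filter fun ω => X ω = s, μ ω

/-- Shannon entropy of `X` in `q`-ary units. -/
def ent (q : ℕ) {Ω : Type} [Fintype Ω] (μ : Ω → ℝ) {α : Type} [Fintype α] (X : Ω → α) : ℝ :=
  -∑ s : α, prb μ X s * Real.logb q (prb μ X s)

/-- Conditional entropy `H(X | Y)` in `q`-ary units. -/
def condEnt (q : ℕ) {Ω : Type} [Fintype Ω] (μ : Ω → ℝ) {α β : Type} [Fintype α] [Fintype β]
    (X : Ω → α) (Y : Ω → β) : ℝ :=
  ent q μ (fun ω => (X ω, Y ω)) - ent q μ Y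

/-- Conditional mutual information `I(X ; Y ∣ Z)` in `q`-ary units. -/
def mutInfo (q : ℕ) {Ω : Type} [Fintype Ω] (μ : Ω → ℝ) {α β γ : Type}
    [Fintype α] [Fintype β] [Fintype γ] (X : Ω → α) (Y : Ω → β) (Z : Ω → γ) : ℝ :=
  condEnt q μ X Z - condEnt q μ X fun ω => (Y ω, Z ω)

/-- The joint random variable formed by the members of a family of random variables
indexed by a finset. -/
def restr {Ω ι α : Type} (Z : ι → Ω → α) (T : Finset ι) : Ω → { i // i ∈ T } → α :=
  fun ω i => Z i.1 ω

/-- The set of users `𝒦`: user `⟨u,v⟩` is the `v`-th user of server `u`. -/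
abbrev Usr (U : ℕ) (V : Fin U → ℕ) : Type := Σ u : Fin U, Fin (V u)

/-- Total number of users, `K = ∑ u, V u`. -/
def Ktot (U : ℕ) (V : Fin U → ℕ) : ℕ := ∑ u, V u

/-- The users connected to server `u`, `𝒦_{{u}}`. -/
def Ksrv (U : ℕ) (V : Fin U → ℕ) (u : Fin U) : Finset (Usr U V) :=
  Finset.univ.filter fun i => i.1 = u

/-- The users connected to a set of servers, `𝒦_𝒰`. -/
def KsrvSet (U : ℕ) (V : Fin U → ℕ) (A : Finset (Fin U)) : Finset (Usr U V) :=
  Finset.univ.filter fun i => i.1 ∈ A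

/-- The set of servers `𝒰^{(m,n)}` associated with a security input set `Sm` and a
colluding set `Tn`. -/
def UServers (U : ℕ) (V : Fin U → ℕ) (Sm Tn : Finset (Usr U V)) : Finset (Fin U) :=
  Finset.univ.filter fun u =>
    (Sm ∩ Ksrv U V u).Nonempty ∧ ((Sm ∪ Tn) ∩ Ksrv U V u).card = V u

/-- The set `(𝒮_m ∩ 𝒦_{{u}}) ∪ 𝒦_{𝒰^{(m,n)}} ∪ 𝒯_n`. -/
def BigB (U : ℕ) (V : Fin U → ℕ) (Sm Tn : Finset (Usr U V)) (u : Fin U) : Finset (Usr U V) :=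
  (Sm ∩ Ksrv U V u) ∪ KsrvSet U V (UServers U V Sm Tn) ∪ Tn

/-- The implicit security input set `𝒮_I`. -/
def SImp (U : ℕ) (V : Fin U → ℕ) {M N : ℕ} (S : Fin M → Finset (Usr U V))
    (T : Fin N → Finset (Usr U V)) : Finset (Usr U V) :=
  Finset.univ.filter fun i =>
    (∀ m, i ∉ S m) ∧
    ∃ u m n, (BigB U V (S m) (T n) u).card = Ktot U V - 1 ∧ i ∉ BigB U V (S m) (T n) u

/-- The total security input set `𝒮̄`. -/
def Sbar (U : ℕ) (V : Fin U → ℕ) {M N : ℕ} (S : Fin M → Finset (Usr U V))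
    (T : Fin N → Finset (Usr U V)) : Finset (Usr U V) :=
  (Finset.univ.biUnion fun m => S m) ∪ SImp U V S T

/-- The set `𝒜_{u,m,n}`. -/
def Aset (U : ℕ) (V : Fin U → ℕ) {M N : ℕ} (S : Fin M → Finset (Usr U V))
    (T : Fin N → Finset (Usr U V)) (u : Fin U) (m : Fin M) (n : Fin N) : Finset (Usr U V) :=
  BigB U V (S m) (T n) u ∩ Sbar U V S T

/-- `a* = max_{u,m,n} |𝒜_{u,m,n}|`. -/
def aStar (U : ℕ) (V : Fin U → ℕ) {M N : ℕ} (S : Fin M → Finset (Usr U V))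
    (T : Fin N → Finset (Usr U V)) : ℕ :=
  Finset.univ.sup fun t : Fin U × Fin M × Fin N => (Aset U V S T t.1 t.2.1 t.2.2).card

/-- `|((𝒮_m ∩ 𝒦_{{u}}) ∪ 𝒯_n) ∩ 𝒮̄| + |𝒰^{(m,n)} ∖ {u}|`. -/
def eVal (U : ℕ) (V : Fin U → ℕ) {M N : ℕ} (S : Fin M → Finset (Usr U V))
    (T : Fin N → Finset (Usr U V)) (u : Fin U) (m : Fin M) (n : Fin N) : ℕ :=
  (((S m ∩ Ksrv U V u) ∪ T n) ∩ Sbar U V S T).card + ((UServers U V (S m) (T n)).erase u).card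

/-- `e* = max_{u,m,n} (|((𝒮_m ∩ 𝒦_{{u}}) ∪ 𝒯_n) ∩ 𝒮̄| + |𝒰^{(m,n)} ∖ {u}|)`. -/
def eStar (U : ℕ) (V : Fin U → ℕ) {M N : ℕ} (S : Fin M → Finset (Usr U V))
    (T : Fin N → Finset (Usr U V)) : ℕ :=
  Finset.univ.sup fun t : Fin U × Fin M × Fin N => eVal U V S T t.1 t.2.1 t.2.2

/-- The set `𝒬_1`. -/
def Q1set (U : ℕ) (V : Fin U → ℕ) {M N : ℕ} (S : Fin M → Finset (Usr U V))
    (T : Fin N → Finset (Usr U V)) : Finset (Usr U V) :=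
  (Finset.univ.filter fun t : Fin U × Fin M × Fin N =>
      (Aset U V S T t.1 t.2.1 t.2.2).card = (Sbar U V S T).card).biUnion
    fun t => BigB U V (S t.2.1) (T t.2.2) t.1

/-- The set `𝒬_2`. -/
def Q2set (U : ℕ) (V : Fin U → ℕ) {M N : ℕ} (S : Fin M → Finset (Usr U V))
    (T : Fin N → Finset (Usr U V)) : Finset (Usr U V) :=
  (Finset.univ.filter fun t : Fin U × Fin M × Fin N =>
      eVal U V S T t.1 t.2.1 t.2.2 = eStar U V S T).biUnion
    fun t => BigB U V (S t.2.1) (T t.2.2) t.1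

/-- The set `𝒬`. -/
def Qset (U : ℕ) (V : Fin U → ℕ) {M N : ℕ} (S : Fin M → Finset (Usr U V))
    (T : Fin N → Finset (Usr U V)) : Finset (Usr U V) :=
  if (Q1set U V S T).Nonempty then Q1set U V S T ∪ Q2set U V S T else ∅

/-- A secure-aggregation scheme: all structural, distributional, correctness and
security constraints of the multi-server secure aggregation model, with entropies in
`q`-ary units for `q = |F|`. -/
def IsScheme (U : ℕ) (V : Fin U → ℕ) (M N : ℕ) (S : Fin M → Finset (Usr U V))
    (T : Fin N → Finset (Usr U V)) (F : Type) [Field F] [Fintype F]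
    (Ω : Type) [Fintype Ω] (μ : Ω → ℝ) (L LX LY LZ LSig : ℕ)
    (W : Usr U V → Ω → Fin L → F) (Z : Usr U V → Ω → Fin LZ → F)
    (X : Usr U V → Ω → Fin LX → F) (Y : Fin U → Ω → Fin LY → F)
    (ZS : Ω → Fin LSig → F) : Prop :=
  let q := Fintype.card F
  (1 ≤ L) ∧
  (∀ ω, 0 ≤ μ ω) ∧ (∑ ω, μ ω = 1) ∧
  -- each input consists of `L` i.i.d. uniform `q`-ary symbols
  (∀ i, ent q μ (W i) = L) ∧
  -- the inputs are mutually independent of each other and of all keys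
  (ent q μ (fun ω => (restr W Finset.univ ω, restr Z Finset.univ ω)) =
    ent q μ (restr Z Finset.univ) + ∑ i, ent q μ (W i)) ∧
  -- the source key consists of `LSig` i.i.d. uniform `q`-ary symbols
  (ent q μ ZS = LSig) ∧
  -- the individual keys are deterministic functions of the source key
  (condEnt q μ (restr Z Finset.univ) ZS = 0) ∧
  -- each user message is a deterministic function of its input and key
  (∀ i, condEnt q μ (X i) (fun ω => (W i ω, Z i ω)) = 0) ∧
  -- each server message is a deterministic function of its received messages
  (∀ u, condEnt q μ (Y u) (restr X (Ksrv U V u)) = 0) ∧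
  -- correctness
  (∀ k, condEnt q μ (fun ω => ∑ i, W i ω)
    (fun ω => (restr Y (Finset.univ.erase k) ω, restr X (Ksrv U V k) ω)) = 0) ∧
  -- security
  (∀ k m n, mutInfo q μ
    (fun ω => (restr Y (Finset.univ.erase k) ω, restr X (Ksrv U V k) ω))
    (restr W (S m))
    (fun ω => (∑ i, W i ω, restr W (T n) ω, restr Z (T n) ω)) = 0)

/-- A rate tuple `(R_X, R_Y, R_{Z_Σ})` is achievable. -/
def Achievable (U : ℕ) (V : Fin U → ℕ) (M N : ℕ) (S : Fin M → Finset (Usr U V))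
    (T : Fin N → Finset (Usr U V)) (R : ℝ × ℝ × ℝ) : Prop :=
  ∃ (F : Type) (iF : Field F) (iFt : Fintype F) (Ω : Type) (iΩ : Fintype Ω)
    (μ : Ω → ℝ) (L LX LY LZ LSig : ℕ)
    (W : Usr U V → Ω → Fin L → F) (Z : Usr U V → Ω → Fin LZ → F)
    (X : Usr U V → Ω → Fin LX → F) (Y : Fin U → Ω → Fin LY → F)
    (ZS : Ω → Fin LSig → F),
    R.1 = (LX : ℝ) / (L : ℝ) ∧ R.2.1 = (LY : ℝ) / (L : ℝ) ∧ R.2.2 = (LSig : ℝ) / (L : ℝ) ∧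
    @IsScheme U V M N S T F iF iFt Ω iΩ μ L LX LY LZ LSig W Z X Y ZS

end

section LinearEntropy

variable {F : Type} [Field F]

/-- The fibers of the random variable `X` are the cosets of the subspace `P`. -/
def HasKernel {Ω : Type} [AddCommGroup Ω] [Module F Ω] {α : Type} (X : Ω → α)
    (P : Submodule F Ω) : Prop :=
  ∀ ω ω', X ω = X ω' ↔ ω - ω' ∈ P

variable {Ω : Type} [AddCommGroup Ω] [Module F Ω]

theorem hasKernel_linearMap {A : Type} [AddCommGroup A] [Module F A] (f : Ω →ₗ[F] A) :
    HasKernel (fun ω => f ω) (LinearMap.ker f) := by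
  intro ω ω'
  rw [LinearMap.mem_ker, map_sub, sub_eq_zero]

theorem HasKernel.prodMk {α β : Type} {X : Ω → α} {Y : Ω → β} {P Q : Submodule F Ω}
    (hX : HasKernel X P) (hY : HasKernel Y Q) :
    HasKernel (fun ω => (X ω, Y ω)) (P ⊓ Q) := by
  intro ω ω'
  rw [Prod.ext_iff, Submodule.mem_inf, ← hX, ← hY]

theorem HasKernel.restr {ι α : Type} {X : ι → Ω → α} {P : ι → Submodule F Ω}
    (hX : ∀ i, HasKernel (X i) (P i)) (T : Finset ι) :
    HasKernel (restr X T) (⨅ i ∈ T, P i) := by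
  intro ω ω'
  simp only [Submodule.mem_iInf, ← fun i => hX i ω ω', funext_iff, Subtype.forall, _root_.restr]

variable [Fintype F] [Fintype Ω]

theorem HasKernel.ent_eq {α : Type} [Fintype α] {X : Ω → α} {P : Submodule F Ω}
    (hX : HasKernel X P) :
    ent (Fintype.card F) (fun _ : Ω => (Fintype.card Ω : ℝ)⁻¹) X =
      (Module.finrank F Ω : ℝ) - Module.finrank F P := by
  set μ : Ω → ℝ := fun _ => (Fintype.card Ω : ℝ)⁻¹ with hμ
  set q := Fintype.card F with hq
  have hq1 : (1 : ℝ) < q := by exact_mod_cast Fintype.one_lt_card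
  have hq0 : (0 : ℝ) < q := by linarith
  have hΩ : (Fintype.card Ω : ℝ) = (q : ℝ) ^ Module.finrank F Ω := by
    rw [Module.card_eq_pow_finrank (K := F) (V := Ω)]; push_cast; rfl
  have hP : (Fintype.card P : ℝ) = (q : ℝ) ^ Module.finrank F P := by
    rw [Module.card_eq_pow_finrank (K := F) (V := P)]; push_cast; rfl
  have hfib : ∀ ω, prb μ X (X ω) = (Fintype.card P : ℝ) * (Fintype.card Ω : ℝ)⁻¹ := by
    intro ω
    have hcard : (univ.filter fun ω' => X ω' = X ω).card = Fintype.card P := by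
      rw [← Fintype.card_coe]
      refine Fintype.card_congr
        { toFun := fun a => ⟨a.1 - ω, (hX _ _).1 (mem_filter.1 a.2).2⟩
          invFun := fun b => ⟨b.1 + ω, by
            simp only [mem_filter, mem_univ, true_and]
            exact (hX _ _).2 (by simp)⟩
          left_inv := fun a => by simp
          right_inv := fun b => by simp }
    simp only [prb, hμ, sum_const, hcard, nsmul_eq_mul]
  have hsum : ∑ s, prb μ X s * Real.logb q (prb μ X s) =
      ∑ ω, μ ω * Real.logb q (prb μ X (X ω)) := by
    rw [← Finset.sum_fiberwise univ X]
    refine sum_congr rfl fun s _ => ?_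
    rw [sum_congr rfl fun ω hω => by rw [(mem_filter.1 hω).2], ← sum_mul, prb]
  rw [ent, hsum]
  simp only [hfib]
  simp only [hμ, sum_const, card_univ, nsmul_eq_mul]
  rw [← mul_assoc, mul_inv_cancel₀ (by rw [hΩ]; positivity), one_mul, hP, hΩ, ← div_eq_mul_inv,
    Real.logb_div (by positivity) (by positivity), Real.logb_pow, Real.logb_pow,
    Real.logb_self_eq_one hq1]
  ring

theorem ent_surjective {A : Type} [AddCommGroup A] [Module F A] [Fintype A] {f : Ω →ₗ[F] A}
    (hf : Function.Surjective f) :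
    ent (Fintype.card F) (fun _ : Ω => (Fintype.card Ω : ℝ)⁻¹) (fun ω => f ω) =
      Module.finrank F A := by
  rw [(hasKernel_linearMap f).ent_eq, ← f.finrank_range_add_finrank_ker,
    LinearMap.range_eq_top.2 hf, finrank_top]
  push_cast
  ring

theorem HasKernel.ent_prodMk {α β : Type} [Fintype α] [Fintype β] {X : Ω → α} {Y : Ω → β}
    {P Q : Submodule F Ω} (hX : HasKernel X P) (hY : HasKernel Y Q) (hPQ : P ⊔ Q = ⊤) :
    ent (Fintype.card F) (fun _ : Ω => (Fintype.card Ω : ℝ)⁻¹) (fun ω => (X ω, Y ω)) =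
      ent (Fintype.card F) (fun _ : Ω => (Fintype.card Ω : ℝ)⁻¹) X +
        ent (Fintype.card F) (fun _ : Ω => (Fintype.card Ω : ℝ)⁻¹) Y := by
  have hdim := Submodule.finrank_sup_add_finrank_inf_eq P Q
  rw [hPQ, finrank_top] at hdim
  have hdim' : (Module.finrank F Ω : ℝ) + Module.finrank F ↥(P ⊓ Q) =
      Module.finrank F P + Module.finrank F Q := by exact_mod_cast hdim
  rw [(hX.prodMk hY).ent_eq, hX.ent_eq, hY.ent_eq]
  linarith

theorem HasKernel.condEnt_eq_zero {α β : Type} [Fintype α] [Fintype β] {X : Ω → α} {Y : Ω → β}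
    {P Q : Submodule F Ω} (hX : HasKernel X P) (hY : HasKernel Y Q) (hQP : Q ≤ P) :
    condEnt (Fintype.card F) (fun _ : Ω => (Fintype.card Ω : ℝ)⁻¹) X Y = 0 := by
  rw [condEnt, (hX.prodMk hY).ent_eq, hY.ent_eq, inf_eq_right.2 hQP, sub_self]

theorem HasKernel.mutInfo_eq_zero {α β γ : Type} [Fintype α] [Fintype β] [Fintype γ]
    {X : Ω → α} {Y : Ω → β} {Z : Ω → γ} {A B C : Submodule F Ω} (hX : HasKernel X A)
    (hY : HasKernel Y B) (hZ : HasKernel Z C) (hC : C ≤ (A ⊓ C) ⊔ (B ⊓ C)) :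
    mutInfo (Fintype.card F) (fun _ : Ω => (Fintype.card Ω : ℝ)⁻¹) X Y Z = 0 := by
  have hsup : (A ⊓ C) ⊔ (B ⊓ C) = C := le_antisymm (sup_le inf_le_right inf_le_right) hC
  have hinf : (A ⊓ C) ⊓ (B ⊓ C) = A ⊓ (B ⊓ C) := by
    rw [inf_assoc, inf_eq_right.2 (inf_le_right : B ⊓ C ≤ C)]
  have hdim := Submodule.finrank_sup_add_finrank_inf_eq (A ⊓ C) (B ⊓ C)
  rw [hsup, hinf] at hdim
  have hdim' : (Module.finrank F C : ℝ) + Module.finrank F ↥(A ⊓ (B ⊓ C)) =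
      Module.finrank F ↥(A ⊓ C) + Module.finrank F ↥(B ⊓ C) := by exact_mod_cast hdim
  rw [mutInfo, condEnt, condEnt, (hX.prodMk hZ).ent_eq, hZ.ent_eq,
    (hX.prodMk (hY.prodMk hZ)).ent_eq, (hY.prodMk hZ).ent_eq]
  linarith

end LinearEntropy

section LinearAlgebra

variable {F : Type} [Field F]

/-- Finitely many subspaces of codimension at most `D` admit a common spanning complement of
dimension at most `D` over a sufficiently large field. -/
theorem exists_common_sup_eq_top [Fintype F] {E : Type} [AddCommGroup E] [Module F E]
    [FiniteDimensional F E] {ι : Type} [Fintype ι] (hι : Fintype.card ι < Fintype.card F)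
    (D : ℕ) (A : ι → Submodule F E)
    (hA : ∀ j, Module.finrank F E ≤ Module.finrank F (A j) + D) :
    ∃ R : Submodule F E, Module.finrank F R ≤ D ∧ ∀ j, R ⊔ A j = ⊤ := by
  induction D generalizing A with
  | zero =>
    refine ⟨⊥, by simp, fun j => ?_⟩
    rw [bot_sup_eq]
    exact Submodule.eq_top_of_finrank_eq (le_antisymm (Submodule.finrank_le _) (hA j))
  | succ D ih =>
    obtain ⟨v, hv⟩ : ∃ v, ∀ j, A j ≠ ⊤ → v ∉ A j := by
      have hlt := Submodule.iUnion_ssubset_of_forall_ne_top_of_card_lt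
        (univ : Finset {j // A j ≠ ⊤}) (fun j => A j.1) (fun j => j.2) (by
          rw [ENat.card_eq_coe_fintype_card, Nat.cast_lt, card_univ]
          exact (Fintype.card_subtype_le _).trans_lt hι)
      obtain ⟨v, -, hv⟩ := Set.exists_of_ssubset hlt
      exact ⟨v, fun j hj hvj => hv (Set.mem_iUnion₂.2 ⟨⟨j, hj⟩, mem_univ _, hvj⟩)⟩
    obtain ⟨R, hR, hRA⟩ := ih (fun j => F ∙ v ⊔ A j) (fun j => by
      by_cases hj : A j = ⊤
      · rw [hj, sup_top_eq, finrank_top]; omega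
      · have hlt : A j < F ∙ v ⊔ A j := by
          refine lt_of_le_of_ne le_sup_right fun h => hv j hj ?_
          rw [h]
          exact Submodule.mem_sup_left (Submodule.mem_span_singleton_self v)
        have := Submodule.finrank_lt_finrank_of_lt hlt
        have := hA j
        omega)
    refine ⟨R ⊔ F ∙ v, ?_, fun j => by rw [sup_assoc, hRA]⟩
    have h1 := Submodule.finrank_add_le_finrank_add_finrank R (F ∙ v)
    have h2 : Module.finrank F (F ∙ v) ≤ 1 := by
      simpa using finrank_span_le_card (R := F) ({v} : Set E)
    omega

theorem exists_surjective_onto {E : Type} [AddCommGroup E] [Module F E] (R : Submodule F E)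
    [FiniteDimensional F E] {n : ℕ} (hn : Module.finrank F R ≤ n) :
    ∃ g : (Fin n → F) →ₗ[F] R, Function.Surjective g := by
  obtain ⟨f, hf⟩ := (finrank_le_iff_exists_linearMap
    (R := F) (M := R) (M' := Fin n → F)).1 (by simpa using hn)
  obtain ⟨g, hg⟩ := LinearMap.exists_leftInverse_of_injective f (LinearMap.ker_eq_bot.2 hf)
  exact ⟨g, fun r => ⟨f r, LinearMap.congr_fun hg r⟩⟩

/-- Any `L` points of the moment curve in `F ^ L` span it. -/
theorem exists_momentCurve_combination {J : Type} [Fintype J] {x : J → F}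
    (hx : Function.Injective x) {L : ℕ} {s : Finset J} (hs : L ≤ s.card) (t : Fin L → F) :
    ∃ y : J → F, (∀ j ∉ s, y j = 0) ∧ ∀ l : Fin L, ∑ j, y j * x j ^ (l : ℕ) = t l := by
  obtain ⟨e⟩ : Nonempty (Fin L ↪ s) :=
    Function.Embedding.nonempty_of_card_le (by simpa using hs)
  set A := Matrix.vandermonde fun i : Fin L => x (e i) with hA
  have hdet : IsUnit A.det := by
    rw [isUnit_iff_ne_zero, hA, Matrix.det_vandermonde_ne_zero_iff]
    exact fun a b hab => e.injective (Subtype.ext (hx hab))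
  set c := Matrix.vecMul t A⁻¹ with hc
  have hcA : Matrix.vecMul c A = t := by
    rw [hc, Matrix.vecMul_vecMul, Matrix.nonsing_inv_mul _ hdet, Matrix.vecMul_one]
  refine ⟨fun j => ∑ i, if (e i : J) = j then c i else 0, fun j hj => ?_, fun l => ?_⟩
  · refine sum_eq_zero fun i _ => if_neg ?_
    rintro rfl
    exact hj (e i).2
  · conv_rhs => rw [← hcA]
    simp only [sum_mul, Matrix.vecMul, dotProduct]
    rw [sum_comm]
    refine sum_congr rfl fun i _ => ?_
    simp [ite_mul, hA, Matrix.vandermonde_apply]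

end LinearAlgebra

section Keys

variable {U : ℕ} {V : Fin U → ℕ} {M N : ℕ} {S : Fin M → Finset (Usr U V)}
  {T : Fin N → Finset (Usr U V)}

theorem subset_Sbar (m : Fin M) : S m ⊆ Sbar U V S T := fun _ hi =>
  mem_union_left _ (mem_biUnion.2 ⟨m, mem_univ m, hi⟩)

theorem card_Ksrv (u : Fin U) : (Ksrv U V u).card = V u := by
  rw [← Fintype.card_fin (V u), ← card_univ,
    ← card_map (Function.Embedding.sigmaMk (β := fun u => Fin (V u)) u)]
  congr 1
  ext ⟨u', v⟩
  simp only [Ksrv, mem_filter, mem_univ, true_and, mem_map, Function.Embedding.sigmaMk_apply]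
  constructor
  · rintro rfl
    exact ⟨v, rfl⟩
  · rintro ⟨w, hw⟩
    exact (congr_arg Sigma.fst hw).symm

/-- A server in `𝒰^{(m,n)}` has all its users in `𝒮_m ∪ 𝒯_n`. -/
theorem mem_union_of_mem_UServers {A B : Finset (Usr U V)} {i : Usr U V}
    (hi : i.1 ∈ UServers U V A B) : i ∈ A ∪ B := by
  have hcard := (mem_filter.1 hi).2.2
  have heq := eq_of_subset_of_card_le (inter_subset_right : (A ∪ B) ∩ Ksrv U V i.1 ⊆ _)
    (by rw [hcard, card_Ksrv])
  have hmem : i ∈ (A ∪ B) ∩ Ksrv U V i.1 := by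
    rw [heq]
    exact mem_filter.2 ⟨mem_univ _, rfl⟩
  exact (mem_inter.1 hmem).1

theorem BigB_subset_union (A B : Finset (Usr U V)) (u : Fin U) : BigB U V A B u ⊆ A ∪ B := by
  intro i hi
  simp only [BigB, KsrvSet, mem_union, mem_inter, mem_filter, mem_univ, true_and] at hi
  rcases hi with (hi | hi) | hi
  · exact mem_union_left _ hi.1
  · exact mem_union_of_mem_UServers hi
  · exact mem_union_right _ hi

variable {F : Type} [Field F] {L : ℕ} {β : Usr U V → ℕ}

/-- Jointly generated keys `p.1` and seeds `p.2`: the keys sum to zero and, outside `B`, user `i`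
has its key determined by `β i` seed symbols through points of the moment curve. -/
def keySpace (B : Finset (Usr U V)) (L : ℕ) (β : Usr U V → ℕ) (x : (Σ i, Fin (β i)) → F) :
    Submodule F ((Usr U V → Fin L → F) × ((Σ i, Fin (β i)) → F)) where
  carrier := {p | (∀ l, ∑ i, p.1 i l = 0) ∧
    ∀ i ∉ B, ∀ l : Fin L, p.1 i l = ∑ a : Fin (β i), p.2 ⟨i, a⟩ * x ⟨i, a⟩ ^ (l : ℕ)}
  add_mem' := by
    rintro p p' ⟨h1, h2⟩ ⟨h1', h2'⟩
    refine ⟨fun l => ?_, fun i hi l => ?_⟩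
    · simp [sum_add_distrib, h1 l, h1' l]
    · simp [h2 i hi l, h2' i hi l, add_mul, sum_add_distrib]
  zero_mem' := by simp
  smul_mem' := by
    rintro c p ⟨h1, h2⟩
    refine ⟨fun l => ?_, fun i hi l => ?_⟩
    · simp [← mul_sum, h1 l]
    · simp [h2 i hi l, mul_sum, mul_assoc]

/-- Keys can be prescribed on `A` if the users outside `A` have enough key randomness left. -/
theorem exists_mem_keySpace {A B : Finset (Usr U V)} {x : (Σ i, Fin (β i)) → F}
    (hx : Function.Injective x) (hAB : B ⊆ A → L ≤ ∑ i ∈ univ \ A, β i)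
    {w : Usr U V → Fin L → F} (hw : ∀ i ∈ A, i ∉ B → w i = 0) :
    ∃ p ∈ keySpace B L β x, (∀ i ∈ A, p.1 i = w i) ∧ ∀ i ∈ A, ∀ a, p.2 ⟨i, a⟩ = 0 := by
  by_cases hBA : B ⊆ A
  · have hcard : L ≤ (univ.filter fun j : Σ i, Fin (β i) => j.1 ∉ A).card := by
      refine (hAB hBA).trans_eq ?_
      have : (univ.filter fun j : Σ i, Fin (β i) => j.1 ∉ A) =
          (univ \ A).sigma fun i => (univ : Finset (Fin (β i))) := by
        ext j; simp
      rw [this, card_sigma]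
      simp
    obtain ⟨y, hy0, hy⟩ := exists_momentCurve_combination hx hcard
      (fun l => -∑ i ∈ A, w i l)
    have hyA : ∀ i ∈ A, ∀ a, y ⟨i, a⟩ = 0 := fun i hi a => hy0 _ (by simp [hi])
    refine ⟨(fun i l => if i ∈ A then w i l else
      ∑ a : Fin (β i), y ⟨i, a⟩ * x ⟨i, a⟩ ^ (l : ℕ), y), ⟨fun l => ?_, fun i hi l => ?_⟩,
      fun i hi => ?_, hyA⟩
    · have hsplit : ∀ i, (if i ∈ A then w i l else
          ∑ a : Fin (β i), y ⟨i, a⟩ * x ⟨i, a⟩ ^ (l : ℕ)) = (if i ∈ A then w i l else 0) +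
            ∑ a : Fin (β i), y ⟨i, a⟩ * x ⟨i, a⟩ ^ (l : ℕ) := by
        intro i
        by_cases hi : i ∈ A
        · simp [hi, hyA i hi]
        · simp [hi]
      simp only [hsplit, sum_add_distrib]
      rw [← Fintype.sum_sigma' (fun i a => y ⟨i, a⟩ * x ⟨i, a⟩ ^ (l : ℕ)), hy l]
      simp
    · by_cases hiA : i ∈ A
      · simp [hiA, hyA i hiA, hw i hiA hi]
      · simp [hiA]
    · ext l
      simp [hi]
  · obtain ⟨j, hjB, hjA⟩ := not_subset.1 hBA
    refine ⟨(fun i l => (if i ∈ A then w i l else 0) + if i = j then -∑ i' ∈ A, w i' l else 0, 0),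
      ⟨fun l => ?_, fun i hi l => ?_⟩, fun i hi => ?_, fun _ _ _ => rfl⟩
    · simp [sum_add_distrib]
    · have hij : i ≠ j := fun h => hi (h ▸ hjB)
      by_cases hiA : i ∈ A
      · simp [hiA, hij, hw i hiA hi]
      · simp [hiA, hij]
    · have hij : i ≠ j := fun h => hjA (h ▸ hi)
      ext l
      simp [hi, hij]

/-- The data of `p ∈ keySpace` that is visible to server `u` and the users in `Tn` once the inputs
in `Sm` are known. -/
def visibleKeys (B Sm Tn : Finset (Usr U V)) (u : Fin U) (x : (Σ i, Fin (β i)) → F) :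
    keySpace B L β x →ₗ[F]
      ({i // i ∈ ((Sm ∩ Ksrv U V u) ∪ Tn) ∩ B} → Fin L → F) ×
      ({u' // u' ∈ (UServers U V Sm Tn).erase u} → Fin L → F) × ((Σ i, Fin (β i)) → F) where
  toFun p := (fun i => p.1.1 i.1, fun u' => ∑ i ∈ Ksrv U V u'.1, p.1.1 i, p.1.2)
  map_add' p p' := by ext <;> simp [sum_add_distrib]
  map_smul' c p := by ext <;> simp [mul_sum]

/-- Correlated keys that sum to zero and whose visible parts can simulate any inputs. -/
theorem exists_keys [Fintype F] {D : ℕ}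
    (hβ : ∀ u m n, Sbar U V S T ⊆ BigB U V (S m) (T n) u →
      L ≤ ∑ i ∈ univ \ BigB U V (S m) (T n) u, β i)
    (hD : eStar U V S T * L + ∑ i, β i ≤ D)
    (hF : Fintype.card (Fin U × Fin M × Fin N) < Fintype.card F)
    (hF' : ∑ i, β i ≤ Fintype.card F) :
    ∃ ζ : (Fin D → F) →ₗ[F] (Usr U V → Fin L → F), (∀ s, ∑ i, ζ s i = 0) ∧
      ∀ k m n (w : Usr U V → Fin L → F), (∀ i ∈ T n, w i = 0) → ∃ s,
        (∀ i ∈ T n, ζ s i = 0) ∧ (∀ i ∈ S m ∩ Ksrv U V k, ζ s i = w i) ∧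
        ∀ u ∈ (UServers U V (S m) (T n)).erase k,
          ∑ i ∈ Ksrv U V u, ζ s i = ∑ i ∈ Ksrv U V u, w i := by
  obtain ⟨x⟩ : Nonempty ((Σ i, Fin (β i)) ↪ F) :=
    Function.Embedding.nonempty_of_card_le (by simpa using hF')
  set B := Sbar U V S T with hB
  set Φ := fun t : Fin U × Fin M × Fin N =>
    visibleKeys (L := L) B (S t.2.1) (T t.2.2) t.1 (x : (Σ i, Fin (β i)) → F) with hΦ
  obtain ⟨R, hRD, hR⟩ := exists_common_sup_eq_top hF D (fun t => LinearMap.ker (Φ t)) (by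
    intro t
    rw [← (Φ t).finrank_range_add_finrank_ker, add_comm]
    refine Nat.add_le_add_left (((Submodule.finrank_le _).trans_eq ?_).trans
      ((Nat.add_le_add_right (Nat.mul_le_mul_right L (?_ : eVal U V S T t.1 t.2.1 t.2.2 ≤ _))
        _).trans hD)) _
    · simp only [Module.finrank_prod, Module.finrank_pi_fintype, Module.finrank_self, sum_const,
        card_univ, Fintype.card_coe, Fintype.card_fin, smul_eq_mul, mul_one, Fintype.card_sigma,
        eVal]
      rw [add_mul, add_assoc]
    · exact le_sup (f := fun t : Fin U × Fin M × Fin N => eVal U V S T t.1 t.2.1 t.2.2)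
        (mem_univ t))
  obtain ⟨g, hg⟩ := exists_surjective_onto R hRD
  refine ⟨(LinearMap.fst F _ _) ∘ₗ (keySpace B L β x).subtype ∘ₗ R.subtype ∘ₗ g, fun s => ?_,
    fun k m n w hw => ?_⟩
  · ext l
    simpa using (g s).1.2.1 l
  obtain ⟨p, hp, hpw, hp0⟩ := exists_mem_keySpace (L := L) x.injective (hβ k m n) (w := w)
    (fun i hi hiB => by
      rcases mem_union.1 (BigB_subset_union _ _ _ hi) with h | h
      · exact absurd (subset_Sbar m h) hiB
      · exact hw i h)
  have hpR : (⟨p, hp⟩ : keySpace B L β x) ∈ R ⊔ LinearMap.ker (Φ (k, m, n)) := by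
    rw [hR]; trivial
  obtain ⟨r, hr, a, ha, hra⟩ := Submodule.mem_sup.1 hpR
  obtain ⟨s, hs⟩ := hg ⟨r, hr⟩
  have hΦr : Φ (k, m, n) r = Φ (k, m, n) ⟨p, hp⟩ := by
    rw [← hra, map_add, LinearMap.mem_ker.1 ha, add_zero]
  have h1 : ∀ i ∈ ((S m ∩ Ksrv U V k) ∪ T n) ∩ B, r.1.1 i = p.1 i := fun i hi =>
    congr_fun (congr_arg Prod.fst hΦr) ⟨i, hi⟩
  have h2 : ∀ u ∈ (UServers U V (S m) (T n)).erase k,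
      ∑ i ∈ Ksrv U V u, r.1.1 i = ∑ i ∈ Ksrv U V u, p.1 i := fun u hu =>
    congr_fun (congr_arg (fun z => z.2.1) hΦr) ⟨u, hu⟩
  have h3 : ∀ j, r.1.2 j = p.2 j := fun j => congr_fun (congr_arg (fun z => z.2.2) hΦr) j
  have hTB : ∀ i ∈ T n, i ∈ BigB U V (S m) (T n) k := fun i hi => mem_union_right _ hi
  have hSB : ∀ i ∈ S m ∩ Ksrv U V k, i ∈ BigB U V (S m) (T n) k := fun i hi =>
    mem_union_left _ (mem_union_left _ hi)
  refine ⟨s, fun i hi => ?_, fun i hi => ?_, fun u hu => ?_⟩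
  · simp only [LinearMap.comp_apply, hs, Submodule.subtype_apply, LinearMap.fst_apply]
    by_cases hiB : i ∈ B
    · rw [h1 i (mem_inter.2 ⟨mem_union_right _ hi, hiB⟩), hpw i (hTB i hi), hw i hi]
    · ext l
      rw [r.2.2 i hiB l]
      simp [h3, hp0 i (hTB i hi)]
  · simp only [LinearMap.comp_apply, hs, Submodule.subtype_apply, LinearMap.fst_apply]
    rw [h1 i (mem_inter.2 ⟨mem_union_left _ hi, subset_Sbar m (mem_inter.1 hi).1⟩),
      hpw i (hSB i hi)]
  · simp only [LinearMap.comp_apply, hs, Submodule.subtype_apply, LinearMap.fst_apply]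
    rw [h2 u hu]
    refine sum_congr rfl fun i hi => hpw i (mem_union_left _ (mem_union_right _ ?_))
    rw [KsrvSet, mem_filter, (mem_filter.1 hi).2]
    exact ⟨mem_univ _, (mem_erase.1 hu).2⟩

end Keys

section Scheme

variable {U : ℕ} {V : Fin U → ℕ} {M N : ℕ} {S : Fin M → Finset (Usr U V)}
  {T : Fin N → Finset (Usr U V)} {F : Type} [Field F] {L : ℕ}

/-- Inputs `w` that vanish on `B` can be changed outside `A` so that the keys `z` hide them. -/
theorem exists_masked_inputs {A B : Finset (Usr U V)} {k : Fin U} {w z : Usr U V → Fin L → F}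
    (hw : ∀ i ∈ B, w i = 0) (hzB : ∀ i ∈ B, z i = 0) (hzA : ∀ i ∈ A ∩ Ksrv U V k, z i = -w i)
    (hz : ∀ u ∈ (UServers U V A B).erase k,
      ∑ i ∈ Ksrv U V u, z i = -∑ i ∈ Ksrv U V u, w i) :
    ∃ w' : Usr U V → Fin L → F, (∀ i ∈ B, w' i = 0) ∧ (∀ i ∈ A, w' i = w i) ∧
      (∀ i ∈ Ksrv U V k, w' i + z i = 0) ∧ ∀ u, ∑ i ∈ Ksrv U V u, (w' i + z i) = 0 := by
  have hserver : ∀ u, ∃ w' : Usr U V → Fin L → F, (∀ i ∈ Ksrv U V u, i ∈ B → w' i = 0) ∧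
      (∀ i ∈ Ksrv U V u, i ∈ A → w' i = w i) ∧ (u = k → ∀ i ∈ Ksrv U V k, w' i + z i = 0) ∧
      ∑ i ∈ Ksrv U V u, (w' i + z i) = 0 := by
    intro u
    by_cases huk : u = k
    · subst huk
      refine ⟨fun i => -z i, fun i _ hi => by simp [hzB i hi], fun i hiu hi => ?_, ?_, ?_⟩
      · simp [hzA i (mem_inter.2 ⟨hi, hiu⟩)]
      · simp
      · simp
    by_cases hu : u ∈ UServers U V A B
    · refine ⟨w, fun i _ hi => hw i hi, fun _ _ _ => rfl, fun h => absurd h huk, ?_⟩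
      rw [sum_add_distrib, hz u (mem_erase.2 ⟨huk, hu⟩), add_neg_cancel]
    by_cases hcover : Ksrv U V u ⊆ A ∪ B
    · have hempty : ∀ i ∈ Ksrv U V u, i ∉ A := fun i hi hiA => hu (mem_filter.2
        ⟨mem_univ _, ⟨i, mem_inter.2 ⟨hiA, hi⟩⟩, by rw [inter_eq_right.2 hcover, card_Ksrv]⟩)
      refine ⟨0, fun _ _ _ => rfl, fun i hi hiA => absurd hiA (hempty i hi),
        fun h => absurd h huk, sum_eq_zero fun i hi => ?_⟩
      rw [hzB i ((mem_union.1 (hcover hi)).resolve_left (hempty i hi))]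
      simp
    · obtain ⟨j, hj, hjAB⟩ := not_subset.1 hcover
      have hne : ∀ i ∈ A ∪ B, i ≠ j := fun i hi h => hjAB (h ▸ hi)
      refine ⟨fun i => (if i ∈ A ∪ B then w i else 0) + if i = j then
        -∑ i ∈ Ksrv U V u, ((if i ∈ A ∪ B then w i else 0) + z i) else 0,
        fun i _ hi => ?_, fun i _ hi => ?_, fun h => absurd h huk, ?_⟩
      · simp [hne i (mem_union_right _ hi), hi, hw i hi]
      · simp [hne i (mem_union_left _ hi), hi]
      · simp only [add_right_comm _ (ite _ _ _) (z _)]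
        rw [sum_add_distrib, sum_ite_eq', if_pos hj, add_neg_cancel]
  choose f hfB hfA hfk hf using hserver
  have hself : ∀ i : Usr U V, i ∈ Ksrv U V i.1 := fun i => mem_filter.2 ⟨mem_univ _, rfl⟩
  refine ⟨fun i => f i.1 i, fun i hi => hfB _ i (hself i) hi, fun i hi => hfA _ i (hself i) hi,
    fun i hi => ?_, fun u => ?_⟩
  · have hik : i.1 = k := (mem_filter.1 hi).2
    exact hfk i.1 hik i hi
  · rw [← hf u]
    refine sum_congr rfl fun i hi => ?_
    have hiu : i.1 = u := (mem_filter.1 hi).2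
    simp only [hiu]

/-- One-time padding the inputs with suitable zero-sum keys and adding the messages at each server
gives a secure aggregation scheme. -/
theorem achievable_of_keys [Fintype F] (hL : 1 ≤ L) {LX LY D : ℕ} (hX : L ≤ LX) (hY : L ≤ LY)
    {ζ : (Fin D → F) →ₗ[F] (Usr U V → Fin L → F)} (hsum : ∀ s, ∑ i, ζ s i = 0)
    (hζ : ∀ k m n (w : Usr U V → Fin L → F), (∀ i ∈ T n, w i = 0) → ∃ s,
        (∀ i ∈ T n, ζ s i = 0) ∧ (∀ i ∈ S m ∩ Ksrv U V k, ζ s i = w i) ∧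
        ∀ u ∈ (UServers U V (S m) (T n)).erase k,
          ∑ i ∈ Ksrv U V u, ζ s i = ∑ i ∈ Ksrv U V u, w i) :
    Achievable U V M N S T ((LX : ℝ) / L, (LY : ℝ) / L, (D : ℝ) / L) := by
  obtain ⟨ιX, hιX⟩ := (finrank_le_iff_exists_linearMap (R := F) (M := Fin L → F)
    (M' := Fin LX → F)).1 (by simpa using hX)
  obtain ⟨ιY, hιY⟩ := (finrank_le_iff_exists_linearMap (R := F) (M := Fin L → F)
    (M' := Fin LY → F)).1 (by simpa using hY)
  let Ω := (Usr U V → Fin L → F) × (Fin D → F)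
  let wmap : Usr U V → Ω →ₗ[F] (Fin L → F) := fun i => LinearMap.proj i ∘ₗ LinearMap.fst F _ _
  let zmap : Usr U V → Ω →ₗ[F] (Fin L → F) := fun i =>
    LinearMap.proj i ∘ₗ ζ ∘ₗ LinearMap.snd F _ _
  let xmap : Usr U V → Ω →ₗ[F] (Fin LX → F) := fun i => ιX ∘ₗ (wmap i + zmap i)
  let ymap : Fin U → Ω →ₗ[F] (Fin LY → F) := fun u =>
    ιY ∘ₗ ∑ i ∈ Ksrv U V u, (wmap i + zmap i)
  have hw : ∀ i (ω : Ω), wmap i ω = ω.1 i := fun _ _ => rfl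
  have hz : ∀ i (ω : Ω), zmap i ω = ζ ω.2 i := fun _ _ => rfl
  have hxker : ∀ i (ω : Ω), xmap i ω = 0 ↔ ω.1 i + ζ ω.2 i = 0 := fun i ω =>
    map_eq_zero_iff ιX hιX
  have hyker : ∀ u (ω : Ω), ymap u ω = 0 ↔ ∑ i ∈ Ksrv U V u, (ω.1 i + ζ ω.2 i) = 0 := by
    intro u ω
    refine (map_eq_zero_iff ιY hιY).trans ?_
    simp [hw, hz]
  have hWk := fun i => hasKernel_linearMap (wmap i)
  have hZk := fun i => hasKernel_linearMap (zmap i)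
  have hXk := fun i => hasKernel_linearMap (xmap i)
  have hYk := fun u => hasKernel_linearMap (ymap u)
  have hWsum : HasKernel (fun ω : Ω => ∑ i, wmap i ω) (LinearMap.ker (∑ i, wmap i)) := by
    simpa using hasKernel_linearMap (∑ i, wmap i)
  have hZS := hasKernel_linearMap (LinearMap.snd F (Usr U V → Fin L → F) (Fin D → F))
  have hW : ∀ i, ent (Fintype.card F) (fun _ : Ω => (Fintype.card Ω : ℝ)⁻¹)
      (fun ω => wmap i ω) = L := fun i => by
    rw [ent_surjective]
    · simp
    · exact fun v => ⟨(fun _ => v, 0), rfl⟩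
  have hobs : ∀ (k : Fin U) (ω : Ω),
      (∀ i ∈ Ksrv U V k, ω.1 i + ζ ω.2 i = 0) →
      (∀ u, u ≠ k → ∑ i ∈ Ksrv U V u, (ω.1 i + ζ ω.2 i) = 0) → ∑ i, ω.1 i = 0 := by
    intro k ω h1 h2
    have h3 : ∑ i, (ω.1 i + ζ ω.2 i) = 0 := by
      rw [← sum_fiberwise univ Sigma.fst]
      refine sum_eq_zero fun u _ => ?_
      by_cases huk : u = k
      · subst huk
        exact sum_eq_zero h1
      · exact h2 u huk
    rwa [sum_add_distrib, hsum, add_zero] at h3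
  refine ⟨F, inferInstance, inferInstance, Ω, inferInstance, fun _ => (Fintype.card Ω : ℝ)⁻¹,
    L, LX, LY, L, D, fun i ω => wmap i ω, fun i ω => zmap i ω, fun i ω => xmap i ω,
    fun u ω => ymap u ω, fun ω => ω.2, rfl, rfl, rfl, hL, fun _ => by positivity, ?_, hW,
    ?_, ?_, ?_, fun i => ?_, fun u => ?_, fun k => ?_, fun k m n => ?_⟩
  · rw [sum_const, card_univ, nsmul_eq_mul, mul_inv_cancel₀]
    exact Nat.cast_ne_zero.2 Fintype.card_ne_zero
  · have hker : (⨅ i ∈ (univ : Finset (Usr U V)), LinearMap.ker (wmap i)) =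
        LinearMap.ker (LinearMap.fst F (Usr U V → Fin L → F) (Fin D → F)) := by
      ext ω
      simp only [Submodule.mem_iInf, LinearMap.mem_ker]
      exact ⟨fun h => funext fun i => h i (mem_univ i), fun h i _ => congr_fun h i⟩
    have hent := hasKernel_linearMap (LinearMap.fst F (Usr U V → Fin L → F) (Fin D → F))
    rw [(HasKernel.restr hWk univ).ent_prodMk (HasKernel.restr hZk univ) ?_, add_comm,
      (HasKernel.restr hWk univ).ent_eq, hker, ← hent.ent_eq, ent_surjective
      LinearMap.fst_surjective, sum_congr rfl fun i _ => hW i]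
    · simp [Module.finrank_pi_fintype]
    · rw [hker, eq_top_iff]
      intro ω _
      refine Submodule.mem_sup.2 ⟨(0, ω.2), ?_, (ω.1, 0), ?_,
        Prod.ext (zero_add _) (add_zero _)⟩
      · exact LinearMap.mem_ker.2 rfl
      · simp [hz, Submodule.mem_iInf]
  · exact (ent_surjective (f := LinearMap.snd F (Usr U V → Fin L → F) (Fin D → F))
      LinearMap.snd_surjective).trans (by simp)
  · refine (HasKernel.restr hZk univ).condEnt_eq_zero hZS fun ω hω => ?_
    have hω' : ω.2 = 0 := hω
    simp [hz, Submodule.mem_iInf, hω']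
  · refine (hXk i).condEnt_eq_zero ((hWk i).prodMk (hZk i)) fun ω hω => ?_
    obtain ⟨h1, h2⟩ := Submodule.mem_inf.1 hω
    rw [LinearMap.mem_ker] at h1 h2 ⊢
    simp [xmap, h1, h2]
  · refine (hYk u).condEnt_eq_zero (HasKernel.restr hXk _) fun ω hω => ?_
    simp only [Submodule.mem_iInf, LinearMap.mem_ker, hxker] at hω
    exact (hyker u ω).2 (sum_eq_zero hω)
  · refine hWsum.condEnt_eq_zero ((HasKernel.restr hYk _).prodMk (HasKernel.restr hXk _))
      fun ω hω => ?_
    simp only [Submodule.mem_inf, Submodule.mem_iInf, LinearMap.mem_ker, hxker, hyker] at hω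
    have h := hobs k ω hω.2 fun u hu => hω.1 u (mem_erase.2 ⟨hu, mem_univ u⟩)
    simpa [hw] using h
  · refine ((HasKernel.restr hYk _).prodMk (HasKernel.restr hXk _)).mutInfo_eq_zero
      (HasKernel.restr hWk _)
      (hWsum.prodMk ((HasKernel.restr hWk _).prodMk (HasKernel.restr hZk _))) fun ω hω => ?_
    have hC : ∀ ω : Ω, ω ∈ LinearMap.ker (∑ i, wmap i) ⊓ ((⨅ i ∈ T n, LinearMap.ker (wmap i)) ⊓
        ⨅ i ∈ T n, LinearMap.ker (zmap i)) ↔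
        ∑ i, ω.1 i = 0 ∧ (∀ i ∈ T n, ω.1 i = 0) ∧ ∀ i ∈ T n, ζ ω.2 i = 0 := by
      intro ω
      simp [Submodule.mem_iInf, hw, hz]
    have hω' := (hC ω).1 hω
    obtain ⟨s, hsT, hsS, hsU⟩ := hζ k m n (fun i => -ω.1 i) (fun i hi => by
      simp [hω'.2.1 i hi])
    obtain ⟨w, hwT, hwS, hwk, hwU⟩ := exists_masked_inputs (z := ζ s) hω'.2.1 hsT hsS
      (fun u hu => by rw [hsU u hu, sum_neg_distrib])
    have hmem := (hC (w, s)).2 ⟨hobs k (w, s) hwk fun u _ => hwU u, hwT, hsT⟩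
    refine Submodule.mem_sup.2 ⟨(w, s), ⟨?_, hmem⟩, ω - (w, s), ⟨?_, sub_mem hω hmem⟩,
      add_sub_cancel _ _⟩
    · simp only [SetLike.mem_coe, Submodule.mem_inf, Submodule.mem_iInf, LinearMap.mem_ker,
        hxker, hyker]
      exact ⟨fun u _ => hwU u, hwk⟩
    · simp only [SetLike.mem_coe, Submodule.mem_iInf, LinearMap.mem_ker]
      intro i hi
      rw [map_sub, hw, hw, sub_eq_zero]
      exact (hwS i hi).symm

theorem achievable_of_seed_lengths (hL : 1 ≤ L) {LX LY D : ℕ} (hX : L ≤ LX) (hY : L ≤ LY)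
    {β : Usr U V → ℕ}
    (hβ : ∀ u m n, Sbar U V S T ⊆ BigB U V (S m) (T n) u →
      L ≤ ∑ i ∈ univ \ BigB U V (S m) (T n) u, β i)
    (hD : eStar U V S T * L + ∑ i, β i ≤ D) :
    Achievable U V M N S T ((LX : ℝ) / L, (LY : ℝ) / L, (D : ℝ) / L) := by
  obtain ⟨p, hp, hprime⟩ := Nat.exists_infinite_primes
    (Fintype.card (Fin U × Fin M × Fin N) + ∑ i, β i + 1)
  have : Fact p.Prime := ⟨hprime⟩
  obtain ⟨ζ, hsum, hζ⟩ := exists_keys (F := ZMod p) hβ hD (by rw [ZMod.card]; omega)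
    (by rw [ZMod.card]; omega)
  exact achievable_of_keys hL hX hY hsum hζ

end Scheme

section Rounding

variable {U : ℕ} {V : Fin U → ℕ} {M N : ℕ} {S : Fin M → Finset (Usr U V)}
  {T : Fin N → Finset (Usr U V)}

/-- Rounding a feasible point of the linear program up to multiples of `1 / L` gives seed
lengths. -/
theorem achievable_of_feasible {b : Usr U V → ℝ} (hb0 : ∀ i, 0 ≤ b i)
    (hb : ∀ u m n, Sbar U V S T ⊆ BigB U V (S m) (T n) u →
      1 ≤ ∑ i ∈ univ \ BigB U V (S m) (T n) u, b i)
    {L LX LY D : ℕ} (hL : 1 ≤ L) (hX : L ≤ LX) (hY : L ≤ LY)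
    (hD : ((eStar U V S T : ℝ) + ∑ i ∈ univ \ Sbar U V S T, b i) * L +
      Fintype.card (Usr U V) ≤ D) :
    Achievable U V M N S T ((LX : ℝ) / L, (LY : ℝ) / L, (D : ℝ) / L) := by
  refine achievable_of_seed_lengths
    (β := fun i => if i ∈ Sbar U V S T then 0 else ⌈b i * L⌉₊) hL hX hY (fun u m n h => ?_) ?_
  · have hle : (L : ℝ) ≤ ∑ i ∈ univ \ BigB U V (S m) (T n) u, (⌈b i * L⌉₊ : ℝ) :=
      calc (L : ℝ) = 1 * L := (one_mul _).symm
        _ ≤ (∑ i ∈ univ \ BigB U V (S m) (T n) u, b i) * L := by gcongr; exact hb u m n h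
        _ = ∑ i ∈ univ \ BigB U V (S m) (T n) u, b i * L := sum_mul _ _ _
        _ ≤ _ := sum_le_sum fun i _ => Nat.le_ceil _
    have heq : ∑ i ∈ univ \ BigB U V (S m) (T n) u,
        (if i ∈ Sbar U V S T then 0 else ⌈b i * L⌉₊) =
          ∑ i ∈ univ \ BigB U V (S m) (T n) u, ⌈b i * L⌉₊ :=
      sum_congr rfl fun i hi => if_neg fun hi' => (mem_sdiff.1 hi).2 (h hi')
    rw [heq]
    exact_mod_cast hle
  · have hceil : (∑ i ∈ univ \ Sbar U V S T, (⌈b i * L⌉₊ : ℝ)) ≤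
        (∑ i ∈ univ \ Sbar U V S T, b i) * L + Fintype.card (Usr U V) :=
      calc (∑ i ∈ univ \ Sbar U V S T, (⌈b i * L⌉₊ : ℝ))
          ≤ ∑ i ∈ univ \ Sbar U V S T, (b i * L + 1) := sum_le_sum fun i _ =>
            (Nat.ceil_lt_add_one (mul_nonneg (hb0 i) (Nat.cast_nonneg L))).le
        _ = (∑ i ∈ univ \ Sbar U V S T, b i) * L + (univ \ Sbar U V S T).card := by
            rw [sum_add_distrib, sum_mul, sum_const, nsmul_eq_mul, mul_one]
        _ ≤ _ := by
            gcongr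
            exact card_le_univ _
    have heq : ∑ i, (if i ∈ Sbar U V S T then 0 else ⌈b i * L⌉₊) =
        ∑ i ∈ univ \ Sbar U V S T, ⌈b i * L⌉₊ := by
      rw [sum_ite, sum_const_zero, zero_add]
      congr 1
      ext i
      simp
    rw [heq, ← Nat.cast_le (α := ℝ)]
    push_cast
    linarith

end Rounding

theorem stmt1_thm2_achievable_region
    (U : ℕ) (hU : 3 ≤ U) (V : Fin U → ℕ) (hV : ∀ u, 1 ≤ V u)
    (M N : ℕ) (S : Fin M → Finset (Usr U V)) (T : Fin N → Finset (Usr U V))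
    (hSmono : ∀ (m : Fin M) (A : Finset (Usr U V)), A ⊆ S m → ∃ m', S m' = A)
    (hTmono : ∀ (n : Fin N) (A : Finset (Usr U V)), A ⊆ T n → ∃ n', T n' = A)
    (hSne : (Finset.univ.biUnion fun m => S m).Nonempty)
    (hTcard : ∀ n, (T n).card ≤ Ktot U V - 2)
    (he : eStar U V S T ≤ Ktot U V - 1)
    (ha : aStar U V S T = (Sbar U V S T).card)
    (hQ : (Qset U V S T).card = Ktot U V)
    (bstar : ℝ)
    (hb : IsLeast {c : ℝ | ∃ b : Usr U V → ℝ, (∀ i, 0 ≤ b i) ∧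
        (∀ (u' : Fin U) (m : Fin M) (n : Fin N), (Aset U V S T u' m n).card = aStar U V S T →
          1 ≤ ∑ i ∈ Finset.univ \ BigB U V (S m) (T n) u', b i) ∧
        c = ∑ i ∈ Finset.univ \ Sbar U V S T, b i} bstar) :
    {R : ℝ × ℝ × ℝ | 1 ≤ R.1 ∧ 1 ≤ R.2.1 ∧ (eStar U V S T : ℝ) + bstar ≤ R.2.2} ⊆
      closure {R : ℝ × ℝ × ℝ | Achievable U V M N S T R} := by
  obtain ⟨⟨b, hb0, hb1, rfl⟩, -⟩ := hb
  rintro ⟨RX, RY, RZ⟩ ⟨hRX, hRY, hRZ⟩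
  simp only at hRX hRY hRZ
  have hb : ∀ u m n, Sbar U V S T ⊆ BigB U V (S m) (T n) u →
      1 ≤ ∑ i ∈ univ \ BigB U V (S m) (T n) u, b i := fun u m n h =>
    hb1 u m n (by rw [Aset, inter_eq_right.2 h, ha])
  have hRZ0 : 0 ≤ RZ := (add_nonneg (Nat.cast_nonneg _) (sum_nonneg fun i _ => hb0 i)).trans hRZ
  have hceil : ∀ {r : ℝ}, 0 ≤ r →
      Filter.Tendsto (fun L : ℕ => (⌈r * L⌉₊ : ℝ) / L) Filter.atTop (nhds r) := fun hr =>
    (tendsto_nat_ceil_mul_div_atTop hr).comp tendsto_natCast_atTop_atTop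
  have hZ : Filter.Tendsto (fun L : ℕ => ((⌈RZ * L⌉₊ + Fintype.card (Usr U V) : ℕ) : ℝ) / L)
      Filter.atTop (nhds RZ) := by
    have h := (hceil hRZ0).add
      (tendsto_const_div_atTop_nhds_zero_nat (Fintype.card (Usr U V) : ℝ))
    rw [add_zero] at h
    refine h.congr fun L => ?_
    push_cast
    ring
  refine mem_closure_of_tendsto ((hceil (zero_le_one.trans hRX)).prodMk_nhds
    ((hceil (zero_le_one.trans hRY)).prodMk_nhds hZ)) ?_
  filter_upwards [Filter.eventually_ge_atTop 1] with L hL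
  have hle : ∀ {r : ℝ}, 1 ≤ r → L ≤ ⌈r * L⌉₊ := fun {r} hr => by
    have h : (L : ℝ) ≤ ⌈r * L⌉₊ :=
      (le_mul_of_one_le_left (Nat.cast_nonneg L) hr).trans (Nat.le_ceil _)
    exact_mod_cast h
  refine achievable_of_feasible hb0 hb hL (hle hRX) (hle hRY) ?_
  push_cast
  gcongr
  exact (mul_le_mul_of_nonneg_right hRZ (Nat.cast_nonneg L)).trans (Nat.le_ceil _)
end

section
/- In the multi-server secure aggregation model, assume only the structural and correctness constraints (the security constraint is not needed). Then for every user (u,v) ∈ 𝒦, H(X_{u,v} | {W_{i,j}, Z_{i,j}}_{(i,j)∈𝒦∖{(u,v)}}) ≥ L. -/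
open Finset

open scoped Classical

theorem restr_eq_iff {Ω ι α : Type} {W : ι → Ω → α} {T : Finset ι} {ω ω' : Ω} :
    restr W T ω = restr W T ω' ↔ ∀ i ∈ T, W i ω = W i ω' := by
  simp [funext_iff, restr]

section Entropy

variable {Ω : Type} [Fintype Ω] {μ : Ω → ℝ} {q : ℕ} {α β γ : Type}

/-- `X` is a function of `Y` on the support of `μ`. -/
def DeterminedBy (μ : Ω → ℝ) (X : Ω → α) (Y : Ω → β) : Prop :=
  ∀ ω ω', 0 < μ ω → 0 < μ ω' → Y ω = Y ω' → X ω = X ω'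

theorem prb_nonneg (hμ : ∀ ω, 0 ≤ μ ω) (X : Ω → α) (s : α) : 0 ≤ prb μ X s :=
  sum_nonneg fun ω _ => hμ ω

theorem prb_self_pos (hμ : ∀ ω, 0 ≤ μ ω) (X : Ω → α) {ω : Ω} (hω : 0 < μ ω) :
    0 < prb μ X (X ω) :=
  hω.trans_le (single_le_sum (f := μ) (fun ω _ => hμ ω) (by simp))

theorem sum_prb_mul [Fintype α] (X : Ω → α) (g : α → ℝ) :
    ∑ s, prb μ X s * g s = ∑ ω, μ ω * g (X ω) := by
  rw [← sum_fiberwise univ X fun ω => μ ω * g (X ω)]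
  refine sum_congr rfl fun s _ => ?_
  rw [prb, sum_mul]
  refine sum_congr ?_ fun ω hω => ?_
  · ext; simp
  · rw [(mem_filter.1 hω).2]

theorem sum_prb [Fintype α] (X : Ω → α) : ∑ s, prb μ X s = ∑ ω, μ ω := by
  simpa using sum_prb_mul (μ := μ) X fun _ => 1

theorem sum_prb_pair [Fintype α] (X : Ω → α) (Z : Ω → γ) (z : γ) :
    ∑ x, prb μ (fun ω => (X ω, Z ω)) (x, z) = prb μ Z z := by
  simp only [prb, sum_filter, Prod.mk.injEq]
  rw [sum_comm]
  refine sum_congr rfl fun ω _ => ?_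
  by_cases h : Z ω = z <;> simp [h]

theorem ent_eq_sum [Fintype α] (X : Ω → α) :
    ent q μ X = ∑ ω, μ ω * -Real.logb q (prb μ X (X ω)) := by
  simp only [ent, sum_prb_mul X fun s => Real.logb q (prb μ X s), mul_neg, sum_neg_distrib]

theorem DeterminedBy.prb_le (hμ : ∀ ω, 0 ≤ μ ω) {X : Ω → α} {Y : Ω → β}
    (h : DeterminedBy μ X Y) {ω : Ω} (hω : 0 < μ ω) :
    prb μ Y (Y ω) ≤ prb μ X (X ω) := by
  simp only [prb, sum_filter]
  refine sum_le_sum fun ω' _ => ?_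
  rcases (hμ ω').eq_or_lt with h0 | h0
  · simp [← h0]
  · by_cases hY : Y ω' = Y ω
    · simp [hY, h ω' ω h0 hω hY]
    · rw [if_neg hY]
      split_ifs <;> first | exact hμ ω' | exact le_rfl

theorem DeterminedBy.ent_le [Fintype α] [Fintype β] (hq : 1 < q) (hμ : ∀ ω, 0 ≤ μ ω)
    {X : Ω → α} {Y : Ω → β} (h : DeterminedBy μ X Y) : ent q μ X ≤ ent q μ Y := by
  rw [ent_eq_sum, ent_eq_sum]
  refine sum_le_sum fun ω _ => ?_
  rcases (hμ ω).eq_or_lt with h0 | h0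
  · simp [← h0]
  · exact mul_le_mul_of_nonneg_left (neg_le_neg (Real.logb_le_logb_of_le (by exact_mod_cast hq)
      (prb_self_pos hμ Y h0) (h.prb_le hμ h0))) (hμ ω)

theorem determinedBy_of_condEnt_eq_zero [Fintype α] [Fintype β] (hq : 1 < q)
    (hμ : ∀ ω, 0 ≤ μ ω) {X : Ω → α} {Y : Ω → β} (h : condEnt q μ X Y = 0) :
    DeterminedBy μ X Y := by
  have hq' : (1 : ℝ) < q := by exact_mod_cast hq
  have hdet : DeterminedBy μ Y fun ω => (X ω, Y ω) := fun _ _ _ _ e => (Prod.ext_iff.1 e).2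
  rw [condEnt, ent_eq_sum, ent_eq_sum, ← sum_sub_distrib, sum_eq_zero_iff_of_nonneg] at h
  · intro ω ω' hω hω' hY
    by_contra hX
    have h1 := h ω (mem_univ ω)
    rw [← mul_sub, mul_eq_zero, or_iff_right hω.ne'] at h1
    have h2 : prb μ (fun ω => (X ω, Y ω)) (X ω, Y ω) = prb μ Y (Y ω) :=
      Real.logb_injOn_pos hq' (prb_self_pos hμ (fun ω => (X ω, Y ω)) hω)
        (prb_self_pos hμ Y hω) (by linarith)
    refine h2.not_lt ?_
    simp only [prb]
    refine sum_lt_sum_of_subset (i := ω') ?_ (by simp [hY]) ?_ hω' fun j _ _ => hμ j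
    · intro j
      simp
    · simp [Ne.symm hX]
  · intro ω _
    rcases (hμ ω).eq_or_lt with h0 | h0
    · simp [← h0]
    · rw [← mul_sub]
      have := Real.logb_le_logb_of_le hq' (prb_self_pos hμ (fun ω => (X ω, Y ω)) h0)
        (hdet.prb_le hμ h0)
      exact mul_nonneg (hμ ω) (by linarith)

theorem sum_mul_prb_ratio_le [Fintype α] [Fintype β] [Fintype γ] (hμ : ∀ ω, 0 ≤ μ ω)
    (X : Ω → α) (Y : Ω → β) (Z : Ω → γ) :
    ∑ ω, μ ω * (prb μ (fun ω => (X ω, Z ω)) (X ω, Z ω) * prb μ (fun ω => (Y ω, Z ω)) (Y ω, Z ω) /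
      (prb μ (fun ω => (X ω, Y ω, Z ω)) (X ω, Y ω, Z ω) * prb μ Z (Z ω))) ≤ ∑ ω, μ ω := by
  rw [← sum_prb_mul (μ := μ) (fun ω => (X ω, Y ω, Z ω)) fun s =>
    prb μ (fun ω => (X ω, Z ω)) (s.1, s.2.2) * prb μ (fun ω => (Y ω, Z ω)) s.2 /
      (prb μ (fun ω => (X ω, Y ω, Z ω)) s * prb μ Z s.2.2)]
  calc
    _ ≤ ∑ s : α × β × γ, prb μ (fun ω => (X ω, Z ω)) (s.1, s.2.2) *
        prb μ (fun ω => (Y ω, Z ω)) s.2 / prb μ Z s.2.2 := by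
      refine sum_le_sum fun s _ => ?_
      rcases (prb_nonneg hμ (fun ω => (X ω, Y ω, Z ω)) s).eq_or_lt with h0 | h0
      · rw [← h0, zero_mul]
        exact div_nonneg (mul_nonneg (prb_nonneg hμ _ _) (prb_nonneg hμ _ _)) (prb_nonneg hμ _ _)
      · rw [← mul_div_assoc, mul_div_mul_left _ _ h0.ne']
    _ = ∑ z, prb μ Z z * prb μ Z z / prb μ Z z := by
      rw [Fintype.sum_prod_type, sum_congr rfl fun x _ => Fintype.sum_prod_type_right _, sum_comm]
      refine sum_congr rfl fun z _ => ?_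
      simp only [← sum_div, ← mul_sum, ← sum_mul, sum_prb_pair]
    _ = ∑ ω, μ ω := by simp only [mul_self_div_self, sum_prb]

theorem ent_submodular [Fintype α] [Fintype β] [Fintype γ] (hq : 1 < q) (hμ : ∀ ω, 0 ≤ μ ω)
    (X : Ω → α) (Y : Ω → β) (Z : Ω → γ) :
    ent q μ (fun ω => (X ω, Y ω, Z ω)) + ent q μ Z ≤
      ent q μ (fun ω => (X ω, Z ω)) + ent q μ (fun ω => (Y ω, Z ω)) := by
  have hlog : 0 < Real.log q := Real.log_pos (by exact_mod_cast hq)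
  have key := sum_mul_prb_ratio_le hμ X Y Z
  simp only [ent_eq_sum, ← sum_add_distrib]
  rw [← sub_nonneg, ← sum_sub_distrib, ← mul_nonneg_iff_of_pos_right hlog, sum_mul]
  rw [← sub_nonneg, ← sum_sub_distrib] at key
  refine key.trans (sum_le_sum fun ω _ => ?_)
  rcases (hμ ω).eq_or_lt with h0 | h0
  · simp [← h0]
  have hxz := prb_self_pos hμ (fun ω => (X ω, Z ω)) h0
  have hyz := prb_self_pos hμ (fun ω => (Y ω, Z ω)) h0
  have hxyz := prb_self_pos hμ (fun ω => (X ω, Y ω, Z ω)) h0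
  have hz := prb_self_pos hμ Z h0
  have h := Real.log_le_sub_one_of_pos (div_pos (mul_pos hxz hyz) (mul_pos hxyz hz))
  rw [Real.log_div (mul_pos hxz hyz).ne' (mul_pos hxyz hz).ne', Real.log_mul hxz.ne' hyz.ne',
    Real.log_mul hxyz.ne' hz.ne'] at h
  have h' := mul_le_mul_of_nonneg_left h (hμ ω)
  simp only [Real.logb, sub_mul, add_mul, mul_assoc, neg_mul, div_mul_cancel₀ _ hlog.ne']
  linarith

theorem ent_pair_le_add [Fintype α] [Fintype β] (hq : 1 < q) (hμ : ∀ ω, 0 ≤ μ ω)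
    (hμ1 : ∑ ω, μ ω = 1) (X : Ω → α) (Y : Ω → β) :
    ent q μ (fun ω => (X ω, Y ω)) ≤ ent q μ X + ent q μ Y := by
  have h := ent_submodular hq hμ X Y fun _ => ()
  have hunit : ent q μ (fun _ : Ω => ()) = 0 := by simp [ent, prb, hμ1]
  have hXY : ent q μ (fun ω => (X ω, Y ω)) ≤ ent q μ (fun ω => (X ω, Y ω, ())) :=
    DeterminedBy.ent_le hq hμ fun ω ω' _ _ e => by simpa using e
  have hX : ent q μ (fun ω => (X ω, ())) ≤ ent q μ X :=
    DeterminedBy.ent_le hq hμ fun ω ω' _ _ e => by simpa using e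
  have hY : ent q μ (fun ω => (Y ω, ())) ≤ ent q μ Y :=
    DeterminedBy.ent_le hq hμ fun ω ω' _ _ e => by simpa using e
  linarith

theorem ent_restr_pair_le {ι : Type} [DecidableEq ι] [Fintype α] [Fintype β] (hq : 1 < q) (hμ : ∀ ω, 0 ≤ μ ω)
    (hμ1 : ∑ ω, μ ω = 1) (W : ι → Ω → α) (Z : Ω → β) (T : Finset ι) :
    ent q μ (fun ω => (restr W T ω, Z ω)) ≤ ent q μ Z + ∑ i ∈ T, ent q μ (W i) := by
  induction T using Finset.induction_on with
  | empty =>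
    rw [sum_empty, add_zero]
    refine DeterminedBy.ent_le hq hμ fun ω ω' _ _ e => ?_
    simp [Prod.ext_iff, restr_eq_iff, e]
  | insert j T hj ih =>
    have hle : ent q μ (fun ω => (restr W (insert j T) ω, Z ω)) ≤
        ent q μ (fun ω => (W j ω, restr W T ω, Z ω)) := by
      refine DeterminedBy.ent_le hq hμ fun ω ω' _ _ e => ?_
      simp only [Prod.mk.injEq, restr_eq_iff, forall_mem_insert] at e ⊢
      tauto
    have := ent_pair_le_add hq hμ hμ1 (W j) fun ω => (restr W T ω, Z ω)
    rw [sum_insert hj]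
    linarith

/-- A member of a family whose values are mutually independent of each other and of all keys
keeps its full entropy given all the other members and their keys. -/
theorem ent_add_ent_others_le {ι κ : Type} [Fintype ι] [DecidableEq ι] [Fintype α] [Fintype κ]
    (hq : 1 < q) (hμ : ∀ ω, 0 ≤ μ ω) (hμ1 : ∑ ω, μ ω = 1) (W : ι → Ω → α) (Z : ι → Ω → κ)
    (hInd : ent q μ (fun ω => (restr W univ ω, restr Z univ ω)) =
      ent q μ (restr Z univ) + ∑ i, ent q μ (W i)) (i : ι) :
    ent q μ (W i) + ent q μ (fun ω => (restr W (univ.erase i) ω, restr Z (univ.erase i) ω)) ≤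
      ent q μ (fun ω => (W i ω, restr W (univ.erase i) ω, restr Z (univ.erase i) ω)) := by
  have hsub := ent_submodular hq hμ (W i) (Z i)
    fun ω => (restr W (univ.erase i) ω, restr Z (univ.erase i) ω)
  have hall : ent q μ (fun ω => (restr W univ ω, restr Z univ ω)) ≤
      ent q μ (fun ω => (W i ω, Z i ω, restr W (univ.erase i) ω, restr Z (univ.erase i) ω)) := by
    refine DeterminedBy.ent_le hq hμ fun ω ω' _ _ e => ?_
    simp only [Prod.mk.injEq, restr_eq_iff, mem_erase, mem_univ, and_true] at e ⊢
    obtain ⟨hW, hZ, hW', hZ'⟩ := e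
    refine ⟨fun j _ => ?_, fun j _ => ?_⟩ <;> by_cases hj : j = i
    · rwa [hj]
    · exact hW' j hj
    · rwa [hj]
    · exact hZ' j hj
  have hkey : ent q μ (fun ω => (Z i ω, restr W (univ.erase i) ω, restr Z (univ.erase i) ω)) ≤
      ent q μ (fun ω => (restr W (univ.erase i) ω, restr Z univ ω)) := by
    refine DeterminedBy.ent_le hq hμ fun ω ω' _ _ e => ?_
    simp only [Prod.mk.injEq, restr_eq_iff] at e ⊢
    exact ⟨e.2 i (mem_univ i), e.1, fun j _ => e.2 j (mem_univ j)⟩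
  have hothers := ent_restr_pair_le hq hμ hμ1 W (restr Z univ) (univ.erase i)
  have hsum := add_sum_erase univ (fun j => ent q μ (W j)) (mem_univ i)
  linarith

end Entropy

theorem stmt4_user_message_entropy
    (U : ℕ) (hU : 3 ≤ U) (V : Fin U → ℕ) (hV : ∀ u, 1 ≤ V u)
    (F : Type) [Field F] [Fintype F] (Ω : Type) [Fintype Ω] (μ : Ω → ℝ)
    (hμ0 : ∀ ω, 0 ≤ μ ω) (hμ1 : ∑ ω, μ ω = 1)
    (L LX LY LZ : ℕ) (hL : 1 ≤ L)
    (W : Usr U V → Ω → Fin L → F) (Z : Usr U V → Ω → Fin LZ → F)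
    (X : Usr U V → Ω → Fin LX → F) (Y : Fin U → Ω → Fin LY → F)
    (hWent : ∀ i, ent (Fintype.card F) μ (W i) = L)
    (hInd : ent (Fintype.card F) μ (fun ω => (restr W Finset.univ ω, restr Z Finset.univ ω)) =
      ent (Fintype.card F) μ (restr Z Finset.univ) + ∑ i, ent (Fintype.card F) μ (W i))
    (hX : ∀ i, condEnt (Fintype.card F) μ (X i) (fun ω => (W i ω, Z i ω)) = 0)
    (hY : ∀ u, condEnt (Fintype.card F) μ (Y u) (restr X (Ksrv U V u)) = 0)
    (hCorr : ∀ k, condEnt (Fintype.card F) μ (fun ω => ∑ i, W i ω)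
      (fun ω => (restr Y (Finset.univ.erase k) ω, restr X (Ksrv U V k) ω)) = 0) :
    ∀ i : Usr U V, (L : ℝ) ≤ condEnt (Fintype.card F) μ (X i)
      (fun ω => (restr W (Finset.univ.erase i) ω, restr Z (Finset.univ.erase i) ω)) := by
  intro i
  have hq : 1 < Fintype.card F := Fintype.one_lt_card
  have hmsg : ∀ ω ω', 0 < μ ω → 0 < μ ω' →
      (∀ j ≠ i, W j ω = W j ω') → (∀ j ≠ i, Z j ω = Z j ω') → X i ω = X i ω' →
      ∀ j, X j ω = X j ω' := by
    intro ω ω' h h' hW hZ hXi j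
    by_cases hj : j = i
    · rwa [hj]
    · exact determinedBy_of_condEnt_eq_zero hq hμ0 (hX j) ω ω' h h'
        (Prod.ext (hW j hj) (hZ j hj))
  have hdet : DeterminedBy μ
      (fun ω => (W i ω, restr W (univ.erase i) ω, restr Z (univ.erase i) ω))
      (fun ω => (X i ω, restr W (univ.erase i) ω, restr Z (univ.erase i) ω)) := by
    intro ω ω' h h' e
    simp only [Prod.mk.injEq, restr_eq_iff, mem_erase, mem_univ, and_true] at e ⊢
    obtain ⟨hXi, hW, hZ⟩ := e
    have hXall := hmsg ω ω' h h' hW hZ hXi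
    have hsum : ∑ j, W j ω = ∑ j, W j ω' := by
      refine determinedBy_of_condEnt_eq_zero hq hμ0 (hCorr i.1) ω ω' h h' ?_
      simp only [Prod.mk.injEq, restr_eq_iff]
      exact ⟨fun u _ => determinedBy_of_condEnt_eq_zero hq hμ0 (hY u) ω ω' h h'
        (restr_eq_iff.2 fun j _ => hXall j), fun j _ => hXall j⟩
    rw [← add_sum_erase univ (fun j => W j ω) (mem_univ i),
      ← add_sum_erase univ (fun j => W j ω') (mem_univ i),
      sum_congr rfl fun j hj => hW j (ne_of_mem_erase hj)] at hsum
    exact ⟨add_right_cancel hsum, hW, hZ⟩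
  have hle := hdet.ent_le hq hμ0
  have hfull := ent_add_ent_others_le hq hμ0 hμ1 W Z hInd i
  rw [hWent] at hfull
  rw [condEnt]
  linarith
end
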